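/- Under Assumptions (A) and (B) with completely symmetric routing (p_{ij} = p for all i ≠ j, 0 < p < 1/(d−1)), the equality sup_{γ∈Γ} min_{1≤i≤d} γ_i (μ_i/(1+γ_i) − ν_i) = min_{1≤i≤d} (√μ_i − √ν_i)² holds if and only if Σ(γ̂_1,…,γ̂_d) ≤ 1. -/

import Mathlib

open scoped BigOperators
open Filter

/-- The `i`-th standard unit vector in `ℤ^d`. -/
def unitZ {d : ℕ} (i : Fin d) : Fin d → ℤ := fun k => if k = i then 1 else 0

/-- The jump rates `q(y)` of the Jackson network: `q(ε^i) = λ_i`,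
`q(-ε^i) = μ_i p_{i0}`, `q(ε^j - ε^i) = μ_i p_{ij}` and `q(y) = 0` otherwise. -/
noncomputable def qrate {d : ℕ} (lam mu : Fin d → ℝ) (P : Fin d → Fin d → ℝ)
    (y : Fin d → ℤ) : ℝ :=
  (∑ i, lam i * (if y = unitZ i then 1 else 0))
    + (∑ i, mu i * (1 - ∑ j, P i j) * (if y = -unitZ i then 1 else 0))
    + (∑ i, ∑ j, mu i * P i j * (if y = unitZ j - unitZ i then 1 else 0))

/-- Assumption (A): irreducibility of the matrix `(q(x - y); x, y ∈ ℤ^d)`. -/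
def AssumptionA {d : ℕ} (lam mu : Fin d → ℝ) (P : Fin d → Fin d → ℝ) : Prop :=
  ∀ x y : Fin d → ℤ, ∃ (n : ℕ) (c : Fin (n + 1) → Fin d → ℤ),
    c 0 = x ∧ c (Fin.last n) = y ∧
      ∀ k : Fin n, 0 < qrate lam mu P (c k.succ - c k.castSucc)

/-- The generator `ℒ` of the Jackson network:
`(ℒ f)(x) = ∑_{z ∈ ℤ_+^d} q(z - x) (f z - f x)`. -/
noncomputable def gen {d : ℕ} (lam mu : Fin d → ℝ) (P : Fin d → Fin d → ℝ)
    (f : (Fin d → ℕ) → ℝ) (x : Fin d → ℕ) : ℝ :=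
  ∑' z : Fin d → ℕ, qrate lam mu P (fun k => (z k : ℤ) - (x k : ℤ)) * (f z - f x)

/-- The hitting-probability matrix `Q j i = G j i / G i i`. -/
noncomputable def hitQ {d : ℕ} (G : Fin d → Fin d → ℝ) : Fin d → Fin d → ℝ :=
  fun j i => G j i / G i i

/-- The vector `γ⃗_i`, with components `γ_i^j = log (1 + Q j i * γ i)`. -/
noncomputable def gvec {d : ℕ} (Q : Fin d → Fin d → ℝ) (γ : Fin d → ℝ) (i j : Fin d) : ℝ :=
  Real.log (1 + Q j i * γ i)

/-- The set `Γ`: all `γ ∈ ℝ_+^d` such that for every `i` and every nonzero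
`v ∈ ℝ_+^d` with `v i = 0` one has `γ⃗_i ⬝ v < max_j γ⃗_j ⬝ v`. -/
def GammaSet (d : ℕ) (Q : Fin d → Fin d → ℝ) : Set (Fin d → ℝ) :=
  {γ | (∀ i, 0 ≤ γ i) ∧
    ∀ i : Fin d, ∀ v : Fin d → ℝ, (∀ j, 0 ≤ v j) → v ≠ 0 → v i = 0 →
      (∑ j, gvec Q γ i j * v j) < ⨆ l : Fin d, ∑ j, gvec Q γ l j * v j}

/-- The function Σ(γ_1,…,γ_d) for the completely symmetric routing matrix, where
qq = p / (1 - (d-2)p) is the common off-diagonal hitting probability. -/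
noncomputable def SigmaFun {d : ℕ} (qq : ℝ) (γ : Fin d → ℝ) : ℝ :=
  ∑ j, ((⨆ i : Fin d, Real.log (1 + qq * γ i)) - Real.log (1 + qq * γ j))
        / (Real.log (1 + γ j) - Real.log (1 + qq * γ j))

/-- m = min_i (√μ_i - √ν_i)². -/
noncomputable def mmin {d : ℕ} (mu ν : Fin d → ℝ) : ℝ :=
  ⨅ i : Fin d, (Real.sqrt (mu i) - Real.sqrt (ν i)) ^ 2

/-- The left endpoint a_i of the interval Δ_i. -/
noncomputable def aEnd {d : ℕ} (mu ν : Fin d → ℝ) (i : Fin d) : ℝ :=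
  (mu i - ν i - mmin mu ν
      - Real.sqrt ((mu i + ν i - mmin mu ν) ^ 2 - 4 * ν i * mu i)) / (2 * ν i)

/-- The right endpoint b_i of the interval Δ_i. -/
noncomputable def bEnd {d : ℕ} (mu ν : Fin d → ℝ) (i : Fin d) : ℝ :=
  (mu i - ν i - mmin mu ν
      + Real.sqrt ((mu i + ν i - mmin mu ν) ^ 2 - 4 * ν i * mu i)) / (2 * ν i)

/-- â = max_i a_i. -/
noncomputable def ahat {d : ℕ} (mu ν : Fin d → ℝ) : ℝ := ⨆ i : Fin d, aEnd mu ν i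

/-- γ̂_i = min {b_i, â}. -/
noncomputable def ghat {d : ℕ} (mu ν : Fin d → ℝ) (i : Fin d) : ℝ :=
  min (bEnd mu ν i) (ahat mu ν)

/-- The numerator logarithm minus the denominator logarithm in the summands of `SigmaFun`. -/
noncomputable def logGap (q x : ℝ) : ℝ := Real.log (1 + x) - Real.log (1 + q * x)

lemma logGap_pos {q x : ℝ} (hq0 : 0 < q) (hq1 : q < 1) (hx : 0 < x) : 0 < logGap q x := by
  have h : q * x < x := by nlinarith
  have := Real.log_lt_log (by positivity : 0 < 1 + q * x) (by linarith : 1 + q * x < 1 + x)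
  unfold logGap
  linarith

lemma logGap_mono {q x y : ℝ} (hq0 : 0 < q) (hq1 : q < 1) (hx : 0 ≤ x) (hxy : x ≤ y) :
    logGap q x ≤ logGap q y := by
  have hy : 0 ≤ y := hx.trans hxy
  have h : (1 + x) * (1 + q * y) ≤ (1 + y) * (1 + q * x) := by nlinarith
  have h2 := Real.log_le_log (by positivity) h
  rw [Real.log_mul (by positivity) (by positivity),
    Real.log_mul (by positivity) (by positivity)] at h2
  unfold logGap
  linarith

lemma log_one_add_mul_mono {q x y : ℝ} (hq0 : 0 < q) (hx : 0 ≤ x) (hxy : x ≤ y) :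
    Real.log (1 + q * x) ≤ Real.log (1 + q * y) :=
  Real.log_le_log (by positivity) (by nlinarith)

lemma log_one_add_mul_concave {q x y t : ℝ} (hq0 : 0 < q) (hx : 0 ≤ x) (hy : 0 ≤ y)
    (ht0 : 0 ≤ t) (ht1 : t ≤ 1) :
    (1 - t) * Real.log (1 + q * x) + t * Real.log (1 + q * y)
      ≤ Real.log (1 + q * ((1 - t) * x + t * y)) := by
  have h := strictConcaveOn_log_Ioi.concaveOn.2
    (show 1 + q * x ∈ Set.Ioi (0 : ℝ) from by simp only [Set.mem_Ioi]; positivity)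
    (show 1 + q * y ∈ Set.Ioi (0 : ℝ) from by simp only [Set.mem_Ioi]; positivity)
    (sub_nonneg.2 ht1) ht0 (by ring)
  simp only [smul_eq_mul] at h
  rw [show 1 + q * ((1 - t) * x + t * y) = (1 - t) * (1 + q * x) + t * (1 + q * y) by ring]
  exact h

lemma sum_gvec_mul {d : ℕ} {Q : Fin d → Fin d → ℝ} {q : ℝ} (hdiag : ∀ i, Q i i = 1)
    (hoff : ∀ i j, i ≠ j → Q i j = q) (γ v : Fin d → ℝ) (l : Fin d) :
    ∑ j, gvec Q γ l j * v j
      = Real.log (1 + q * γ l) * ∑ j, v j + logGap q (γ l) * v l := by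
  have h : ∀ j, gvec Q γ l j * v j
      = Real.log (1 + q * γ l) * v j + if j = l then logGap q (γ l) * v j else 0 := by
    intro j
    unfold gvec logGap
    by_cases hj : j = l
    · subst hj
      simp only [hdiag, if_true, one_mul]
      ring
    · simp [hj, hoff j l hj]
  simp only [h, Finset.sum_add_distrib, ← Finset.mul_sum]
  simp

lemma sigmaFun_eq {d : ℕ} {q : ℝ} {γ : Fin d → ℝ} (hq0 : 0 < q) (hγ : ∀ i, 0 ≤ γ i)
    {k : Fin d} (hk : ∀ i, γ i ≤ γ k) :
    SigmaFun q γ = ∑ j, (Real.log (1 + q * γ k) - Real.log (1 + q * γ j)) / logGap q (γ j) := by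
  have : (⨆ i : Fin d, Real.log (1 + q * γ i)) = Real.log (1 + q * γ k) := by
    have : Nonempty (Fin d) := ⟨k⟩
    apply le_antisymm
    · exact ciSup_le fun i => log_one_add_mul_mono hq0 (hγ i) (hk i)
    · exact le_ciSup (f := fun i => Real.log (1 + q * γ i)) (Set.finite_range _).bddAbove k
  unfold SigmaFun
  rw [this]
  rfl

/-- For completely symmetric routing, a vector with positive coordinates belongs to `Γ`
exactly when `Σ < 1`. -/
lemma mem_gammaSet_iff {d : ℕ} (hd : 0 < d) {Q : Fin d → Fin d → ℝ} {q : ℝ}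
    (hq0 : 0 < q) (hq1 : q < 1) (hdiag : ∀ i, Q i i = 1)
    (hoff : ∀ i j, i ≠ j → Q i j = q) {γ : Fin d → ℝ} (hγ : ∀ i, 0 < γ i) :
    γ ∈ GammaSet d Q ↔ SigmaFun q γ < 1 := by
  have : Nonempty (Fin d) := ⟨⟨0, hd⟩⟩
  obtain ⟨k, hk⟩ := Finite.exists_max γ
  rw [sigmaFun_eq hq0 (fun i => (hγ i).le) hk]
  have hD : ∀ j, 0 < logGap q (γ j) := fun j => logGap_pos hq0 hq1 (hγ j)
  have hL : ∀ j, Real.log (1 + q * γ j) ≤ Real.log (1 + q * γ k) := fun j =>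
    log_one_add_mul_mono hq0 (hγ j).le (hk j)
  set w : Fin d → ℝ := fun j =>
    (Real.log (1 + q * γ k) - Real.log (1 + q * γ j)) / logGap q (γ j) with hw
  have hw0 : ∀ j, 0 ≤ w j := fun j => div_nonneg (sub_nonneg.2 (hL j)) (hD j).le
  have hwD : ∀ j, logGap q (γ j) * w j
      = Real.log (1 + q * γ k) - Real.log (1 + q * γ j) := fun j =>
    mul_div_cancel₀ _ (hD j).ne'
  constructor
  · intro h
    by_contra! hS
    have hne : w ≠ 0 := by
      intro h0
      simp only [h0, Pi.zero_apply, Finset.sum_const_zero] at hS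
      linarith
    have h1 := h.2 k w hw0 hne (by simp [hw])
    simp only [sum_gvec_mul hdiag hoff] at h1
    refine absurd h1 (not_lt.2 (ciSup_le fun l => ?_))
    have hwk : w k = 0 := by simp [hw]
    rw [hwD, hwk]
    nlinarith [mul_nonneg (sub_nonneg.2 (hL l)) (sub_nonneg.2 hS)]
  · intro hS
    refine ⟨fun i => (hγ i).le, fun i v hv hv0 hvi => ?_⟩
    simp only [sum_gvec_mul hdiag hoff]
    by_contra! hcon
    have hall : ∀ l, Real.log (1 + q * γ l) * ∑ j, v j + logGap q (γ l) * v l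
        ≤ Real.log (1 + q * γ i) * ∑ j, v j + logGap q (γ i) * v i := fun l =>
      (le_ciSup (f := fun l => Real.log (1 + q * γ l) * ∑ j, v j + logGap q (γ l) * v l)
        (Set.finite_range _).bddAbove l).trans hcon
    have hpos : 0 < ∑ j, v j := by
      obtain ⟨j, hj⟩ := Function.ne_iff.1 hv0
      exact Finset.sum_pos' (fun j _ => hv j)
        ⟨j, Finset.mem_univ _, lt_of_le_of_ne (hv j) (Ne.symm hj)⟩
    have hle : ∀ l, v l ≤ w l * ∑ j, v j := by
      intro l
      have h1 := hall l
      rw [hvi, mul_zero, add_zero] at h1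
      have h2 := mul_le_mul_of_nonneg_right (hL i) hpos.le
      refine le_of_mul_le_mul_left ?_ (hD l)
      rw [← mul_assoc, hwD]
      linarith
    have hsum := Finset.sum_le_sum fun l (_ : l ∈ Finset.univ) => hle l
    rw [← Finset.sum_mul] at hsum
    nlinarith

/-- The left root of `ν t² - (μ - ν - s) t + s`. -/
noncomputable def lowerRoot (μ ν s : ℝ) : ℝ :=
  (μ - ν - s - Real.sqrt ((μ + ν - s) ^ 2 - 4 * ν * μ)) / (2 * ν)

/-- The right root of `ν t² - (μ - ν - s) t + s`. -/
noncomputable def upperRoot (μ ν s : ℝ) : ℝ :=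
  (μ - ν - s + Real.sqrt ((μ + ν - s) ^ 2 - 4 * ν * μ)) / (2 * ν)

lemma le_payoff_iff_sq_le {μ ν s t : ℝ} (hν : 0 < ν) (ht : 0 ≤ t) :
    s ≤ t * (μ / (1 + t) - ν)
      ↔ (2 * ν * t - (μ - ν - s)) ^ 2 ≤ (μ + ν - s) ^ 2 - 4 * ν * μ := by
  have h1 : 0 < 1 + t := by linarith
  have h2 : t * (μ / (1 + t) - ν) = (t * μ - t * ν * (1 + t)) / (1 + t) := by
    field_simp
  have h3 : (2 * ν * t - (μ - ν - s)) ^ 2 - ((μ + ν - s) ^ 2 - 4 * ν * μ)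
      = 4 * ν * (s * (1 + t) - (t * μ - t * ν * (1 + t))) := by ring
  rw [h2, le_div_iff₀ h1, ← sub_nonpos, ← sub_nonpos (b := (μ + ν - s) ^ 2 - 4 * ν * μ), h3]
  constructor
  · intro h
    exact mul_nonpos_of_nonneg_of_nonpos (by positivity) h
  · intro h
    exact nonpos_of_mul_nonpos_right h (by positivity)

lemma roots_bounds_of_le_payoff {μ ν s t : ℝ} (hν : 0 < ν) (ht : 0 ≤ t)
    (h : s ≤ t * (μ / (1 + t) - ν)) : lowerRoot μ ν s ≤ t ∧ t ≤ upperRoot μ ν s := by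
  have h1 := abs_le.1 (Real.abs_le_sqrt ((le_payoff_iff_sq_le hν ht).1 h))
  unfold lowerRoot upperRoot
  rw [div_le_iff₀ (by positivity), le_div_iff₀ (by positivity)]
  constructor <;> linarith [h1.1, h1.2]

lemma le_payoff_of_roots_bounds {μ ν s t : ℝ} (hν : 0 < ν) (ht : 0 ≤ t)
    (hdisc : 0 ≤ (μ + ν - s) ^ 2 - 4 * ν * μ)
    (h1 : lowerRoot μ ν s ≤ t) (h2 : t ≤ upperRoot μ ν s) :
    s ≤ t * (μ / (1 + t) - ν) := by
  rw [le_payoff_iff_sq_le hν ht, ← Real.sq_sqrt hdisc]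
  unfold lowerRoot at h1
  unfold upperRoot at h2
  rw [div_le_iff₀ (by positivity)] at h1
  rw [le_div_iff₀ (by positivity)] at h2
  apply sq_le_sq'
  · linarith
  · linarith

lemma discriminant_nonneg {μ ν s : ℝ} (hν : 0 < ν) (hμ : ν < μ)
    (hs : s ≤ (Real.sqrt μ - Real.sqrt ν) ^ 2) : 0 ≤ (μ + ν - s) ^ 2 - 4 * ν * μ := by
  have h1 := Real.sq_sqrt hν.le
  have h2 := Real.sq_sqrt (hν.trans hμ).le
  have h3 : 2 * (Real.sqrt μ * Real.sqrt ν) ≤ μ + ν - s := by nlinarith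
  have h4 : 0 ≤ 2 * (Real.sqrt μ * Real.sqrt ν) := by positivity
  have h5 := pow_le_pow_left₀ h4 h3 2
  have h6 : (2 * (Real.sqrt μ * Real.sqrt ν)) ^ 2 = 4 * ν * μ := by
    rw [mul_pow, mul_pow, h1, h2]; ring
  linarith

lemma lowerRoot_pos {μ ν s : ℝ} (hν : 0 < ν) (hμ : ν < μ) (hs0 : 0 < s)
    (hs : s ≤ (Real.sqrt μ - Real.sqrt ν) ^ 2) : 0 < lowerRoot μ ν s := by
  have h1 := Real.sq_sqrt hν.le
  have h2 := Real.sq_sqrt (hν.trans hμ).le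
  have h3 : Real.sqrt ν < Real.sqrt μ := Real.sqrt_lt_sqrt hν.le hμ
  have h4 : 0 < Real.sqrt ν := Real.sqrt_pos.2 hν
  have h5 : 0 < μ - ν - s := by nlinarith
  unfold lowerRoot
  apply div_pos _ (by positivity)
  rw [sub_pos, Real.sqrt_lt' h5]
  nlinarith

lemma lowerRoot_le_upperRoot {μ ν : ℝ} (s : ℝ) (hν : 0 < ν) :
    lowerRoot μ ν s ≤ upperRoot μ ν s := by
  unfold lowerRoot upperRoot
  have := Real.sqrt_nonneg ((μ + ν - s) ^ 2 - 4 * ν * μ)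
  gcongr
  linarith

lemma continuous_lowerRoot (μ ν : ℝ) : Continuous (lowerRoot μ ν) := by
  unfold lowerRoot
  fun_prop

lemma continuous_upperRoot (μ ν : ℝ) : Continuous (upperRoot μ ν) := by
  unfold upperRoot
  fun_prop

lemma payoff_le_sq {μ ν t : ℝ} (hν : 0 < ν) (hμ : ν < μ) (ht : 0 ≤ t) :
    t * (μ / (1 + t) - ν) ≤ (Real.sqrt μ - Real.sqrt ν) ^ 2 := by
  have h1 := Real.sq_sqrt hν.le
  have h2 := Real.sq_sqrt (hν.trans hμ).le
  have h3 : 0 < 1 + t := by linarith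
  have h4 : t * (μ / (1 + t) - ν) = (t * μ - t * ν * (1 + t)) / (1 + t) := by
    field_simp
  rw [h4, div_le_iff₀ h3]
  have h5 : (Real.sqrt μ - Real.sqrt ν) ^ 2 * (1 + t)
      - (t * Real.sqrt μ ^ 2 - t * Real.sqrt ν ^ 2 * (1 + t))
      = (Real.sqrt μ - (1 + t) * Real.sqrt ν) ^ 2 := by ring
  rw [h1, h2] at h5
  linarith [sq_nonneg (Real.sqrt μ - (1 + t) * Real.sqrt ν)]

lemma mmin_le {d : ℕ} (mu ν : Fin d → ℝ) (i : Fin d) :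
    mmin mu ν ≤ (Real.sqrt (mu i) - Real.sqrt (ν i)) ^ 2 :=
  ciInf_le (Set.finite_range fun i => (Real.sqrt (mu i) - Real.sqrt (ν i)) ^ 2).bddBelow i

lemma mmin_pos {d : ℕ} (hd : 0 < d) {mu ν : Fin d → ℝ} (hν : ∀ i, 0 < ν i)
    (hB : ∀ i, ν i < mu i) : 0 < mmin mu ν := by
  have : Nonempty (Fin d) := ⟨⟨0, hd⟩⟩
  obtain ⟨i, hi⟩ := exists_eq_ciInf_of_finite
    (f := fun i : Fin d => (Real.sqrt (mu i) - Real.sqrt (ν i)) ^ 2)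
  unfold mmin
  rw [← hi]
  exact pow_pos (sub_pos.2 (Real.sqrt_lt_sqrt (hν i).le (hB i))) 2

/-- The summands of `Σ` can only decrease when every coordinate is replaced by an upper bound
truncated at a level not exceeding the maximal coordinate. -/
lemma sum_truncated_le_sigmaFun {d : ℕ} {q : ℝ} (hq0 : 0 < q) (hq1 : q < 1)
    {γ b : Fin d → ℝ} {α : ℝ} (hγ : ∀ i, 0 < γ i) (hb : ∀ i, γ i ≤ b i) {k : Fin d}
    (hα : α ≤ γ k) :
    ∑ j, (Real.log (1 + q * α) - Real.log (1 + q * min (b j) α)) / logGap q (min (b j) α)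
      ≤ SigmaFun q γ := by
  have : Nonempty (Fin d) := ⟨k⟩
  obtain ⟨k', hk'⟩ := Finite.exists_max γ
  rw [sigmaFun_eq hq0 (fun i => (hγ i).le) hk']
  refine Finset.sum_le_sum fun j _ => ?_
  have hD := logGap_pos hq0 hq1 (hγ j)
  have hj := log_one_add_mul_mono hq0 (hγ j).le (hk' j)
  rcases le_or_gt α (b j) with h | h
  · rw [min_eq_right h, sub_self, zero_div]
    exact div_nonneg (sub_nonneg.2 hj) hD.le
  · rw [min_eq_left h.le]
    have hbj : 0 < b j := (hγ j).trans_le (hb j)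
    have h1 := log_one_add_mul_mono hq0 (hbj.trans h).le (hα.trans (hk' k))
    have h2 := log_one_add_mul_mono hq0 (hγ j).le (hb j)
    exact div_le_div₀ (sub_nonneg.2 hj) (by linarith) hD
      (logGap_mono hq0 hq1 (hγ j).le (hb j))

/-- Moving all coordinates towards the maximal one contracts `Σ`. -/
lemma sigmaFun_interpolate_le {d : ℕ} {q : ℝ} (hq0 : 0 < q) (hq1 : q < 1)
    {γ : Fin d → ℝ} (hγ : ∀ i, 0 < γ i) {k : Fin d} (hk : ∀ i, γ i ≤ γ k) {t : ℝ}
    (ht0 : 0 ≤ t) (ht1 : t ≤ 1) :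
    SigmaFun q (fun i => (1 - t) * γ i + t * γ k) ≤ (1 - t) * SigmaFun q γ := by
  have ht : 0 ≤ 1 - t := sub_nonneg.2 ht1
  have hge : ∀ i, γ i ≤ (1 - t) * γ i + t * γ k := fun i => by
    nlinarith [mul_nonneg ht0 (sub_nonneg.2 (hk i))]
  rw [sigmaFun_eq hq0 (fun i => (hγ i).le) hk,
    sigmaFun_eq (k := k) hq0 (fun i => (hγ i).le.trans (hge i))
      (fun i => by nlinarith [mul_nonneg ht (sub_nonneg.2 (hk i))]), Finset.mul_sum]
  refine Finset.sum_le_sum fun j _ => ?_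
  rw [← mul_div_assoc]
  have hkk : (1 - t) * γ k + t * γ k = γ k := by ring
  simp only [hkk]
  have h1 := log_one_add_mul_concave hq0 (hγ j).le (hγ k).le ht0 ht1
  have h2 := log_one_add_mul_mono hq0 (hγ j).le (hk j)
  exact div_le_div₀ (mul_nonneg ht (sub_nonneg.2 h2)) (by linarith)
    (logGap_pos hq0 hq1 (hγ j)) (logGap_mono hq0 hq1 (hγ j).le (hge j))

/-- Proposition 3.4: for completely symmetric routing,
sup_{γ ∈ Γ} min_i γ_i (μ_i/(1+γ_i) - ν_i) = min_i (√μ_i - √ν_i)²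
holds if and only if Σ(γ̂_1,…,γ̂_d) ≤ 1. -/
theorem stmt14
    (d : ℕ) (hd : 0 < d)
    (lam mu : Fin d → ℝ) (P : Fin d → Fin d → ℝ)
    (hlam : ∀ i, 0 ≤ lam i) (hmu : ∀ i, 0 < mu i)
    (hP : ∀ i j, 0 ≤ P i j) (hPdiag : ∀ i, P i i = 0) (hP0 : ∀ i, ∑ j, P i j ≤ 1)
    (hA : AssumptionA lam mu P)
    (G : Fin d → Fin d → ℝ)
    (hG1 : ∀ i k, ∑ j, G i j * ((if j = k then (1 : ℝ) else 0) - P j k)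
      = if i = k then 1 else 0)
    (hG2 : ∀ i k, ∑ j, ((if i = j then (1 : ℝ) else 0) - P i j) * G j k
      = if i = k then 1 else 0)
    (hGnn : ∀ i j, 0 ≤ G i j) (hGdiag : ∀ i, 1 ≤ G i i)
    (ν : Fin d → ℝ) (hν : ∀ j, ν j = lam j + ∑ i, ν i * P i j) (hνpos : ∀ i, 0 < ν i)
    (hB : ∀ i, ν i < mu i)
    (p : ℝ) (hp : 0 < p) (hpd : p < 1 / ((d : ℝ) - 1))
    (hsym : ∀ i j : Fin d, i ≠ j → P i j = p)
    (hQ : ∀ i j : Fin d, i ≠ j → hitQ G i j = p / (1 - ((d : ℝ) - 2) * p)) :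
    sSup ((fun γ : Fin d → ℝ => ⨅ i : Fin d, γ i * (mu i / (1 + γ i) - ν i)) ''
          GammaSet d (hitQ G))
        = mmin mu ν
      ↔ SigmaFun (p / (1 - ((d : ℝ) - 2) * p)) (ghat mu ν) ≤ 1 := by
  have : Nonempty (Fin d) := ⟨⟨0, hd⟩⟩
  have hd1 : (1 : ℝ) < d := by
    have h : (0 : ℝ) < (d : ℝ) - 1 := one_div_pos.1 (hp.trans hpd)
    linarith
  have hdp : p * ((d : ℝ) - 1) < 1 := (lt_div_iff₀ (by linarith)).1 hpd
  have hden : 0 < 1 - ((d : ℝ) - 2) * p := by nlinarith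
  set q : ℝ := p / (1 - ((d : ℝ) - 2) * p) with hq
  have hq0 : 0 < q := div_pos hp hden
  have hq1 : q < 1 := by
    rw [hq, div_lt_one hden]
    nlinarith
  have hdiag : ∀ i, hitQ G i i = 1 := fun i => div_self (by linarith [hGdiag i])
  set m := mmin mu ν with hm
  have hm0 : 0 < m := mmin_pos hd hνpos hB
  have hmle := mmin_le mu ν
  have ha0 : ∀ i, 0 < aEnd mu ν i := fun i =>
    lowerRoot_pos (hνpos i) (hB i) hm0 (hmle i)
  have hab : ∀ i, aEnd mu ν i ≤ bEnd mu ν i := fun i => lowerRoot_le_upperRoot _ (hνpos i)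
  obtain ⟨k, hk⟩ := exists_eq_ciSup_of_finite (f := aEnd mu ν)
  change aEnd mu ν k = ahat mu ν at hk
  have hale : ∀ i, aEnd mu ν i ≤ ahat mu ν := fun i =>
    le_ciSup (Set.finite_range (aEnd mu ν)).bddAbove i
  have hga : ∀ i, aEnd mu ν i ≤ ghat mu ν i := fun i => le_min (hab i) (hale i)
  have hg0 : ∀ i, 0 < ghat mu ν i := fun i => (ha0 i).trans_le (hga i)
  have hgk : ghat mu ν k = ahat mu ν := min_eq_right (hk ▸ hab k)
  have hgmax : ∀ i, ghat mu ν i ≤ ghat mu ν k := fun i => by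
    rw [hgk]; exact min_le_right _ _
  set F : (Fin d → ℝ) → ℝ := fun γ => ⨅ i : Fin d, γ i * (mu i / (1 + γ i) - ν i) with hF
  have hFle : ∀ γ i, F γ ≤ γ i * (mu i / (1 + γ i) - ν i) := fun γ i =>
    ciInf_le (Set.finite_range fun i => γ i * (mu i / (1 + γ i) - ν i)).bddBelow i
  have hub : ∀ x ∈ F '' GammaSet d (hitQ G), x ≤ m := by
    rintro _ ⟨γ, hγ, rfl⟩
    exact le_ciInf fun i => (hFle γ i).trans (payoff_le_sq (hνpos i) (hB i) (hγ.1 i))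
  constructor
  · intro hsup
    have hne : (F '' GammaSet d (hitQ G)).Nonempty := by
      by_contra h
      rw [Set.not_nonempty_iff_eq_empty.1 h, Real.sSup_empty] at hsup
      linarith
    set T : ℝ → ℝ := fun s => ∑ j,
      (Real.log (1 + q * lowerRoot (mu k) (ν k) s)
        - Real.log (1 + q * min (upperRoot (mu j) (ν j) s) (lowerRoot (mu k) (ν k) s)))
        / logGap q (min (upperRoot (mu j) (ν j) s) (lowerRoot (mu k) (ν k) s)) with hT
    have hTm : SigmaFun q (ghat mu ν) = T m := by
      rw [sigmaFun_eq hq0 (fun i => (hg0 i).le) hgmax, hgk]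
      unfold ghat
      rw [← hk]
      rfl
    have hTlt : ∀ s, 0 < s → s < m → T s ≤ 1 := by
      intro s hs0 hs
      obtain ⟨_, ⟨γ, hγ, rfl⟩, hsγ⟩ := exists_lt_of_lt_csSup hne (hs.trans_eq hsup.symm)
      have hsi : ∀ i, s ≤ γ i * (mu i / (1 + γ i) - ν i) := fun i => hsγ.le.trans (hFle γ i)
      have hpos : ∀ i, 0 < γ i := by
        intro i
        refine lt_of_le_of_ne (hγ.1 i) fun h0 => ?_
        have := hsi i
        rw [← h0, zero_mul] at this
        linarith
      have hbd := fun i => roots_bounds_of_le_payoff (hνpos i) (hγ.1 i) (hsi i)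
      exact (sum_truncated_le_sigmaFun hq0 hq1 hpos (fun i => (hbd i).2) (hbd k).1).trans
        ((mem_gammaSet_iff hd hq0 hq1 hdiag hQ hpos).1 hγ).le
    have hcont : ContinuousAt T m := by
      have hla : ContinuousAt (lowerRoot (mu k) (ν k)) m := (continuous_lowerRoot _ _).continuousAt
      have hak : 0 < lowerRoot (mu k) (ν k) m := ha0 k
      have hq' : ∀ x : ℝ, 0 < x → 1 + q * x ≠ 0 := fun x hx => by positivity
      refine tendsto_finsetSum _ fun j _ => ?_
      have hg : ContinuousAt
          (fun s => min (upperRoot (mu j) (ν j) s) (lowerRoot (mu k) (ν k) s)) m :=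
        (continuous_upperRoot _ _).continuousAt.min hla
      have hgp : 0 < min (upperRoot (mu j) (ν j) m) (lowerRoot (mu k) (ν k) m) :=
        lt_min ((ha0 j).trans_le (hab j)) hak
      have hlg := (continuousAt_const.add (continuousAt_const.mul hg)).log (hq' _ hgp)
      exact (((continuousAt_const.add (continuousAt_const.mul hla)).log (hq' _ hak)).sub hlg).div
        (((continuousAt_const.add hg).log (add_pos one_pos hgp).ne').sub hlg)
        (logGap_pos hq0 hq1 hgp).ne'
    rw [hTm]
    refine le_of_tendsto (hcont.mono_left (nhdsWithin_le_nhds (s := Set.Iio m))) ?_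
    filter_upwards [Ioo_mem_nhdsLT hm0] with s hs
    exact hTlt s hs.1 hs.2
  · intro hS
    have hbdd : BddAbove (F '' GammaSet d (hitQ G)) := ⟨m, hub⟩
    set g : ℝ → Fin d → ℝ := fun t i => (1 - t) * ghat mu ν i + t * ghat mu ν k with hg
    have hgpos : ∀ t, 0 ≤ t → t ≤ 1 → ∀ i, 0 < g t i := fun t h0 h1 i => by
      have := mul_nonneg h0 (sub_nonneg.2 (hgmax i))
      have := hg0 i
      simp only [hg]
      nlinarith
    have hgmem : ∀ t, 0 < t → t ≤ 1 → g t ∈ GammaSet d (hitQ G) := by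
      intro t h0 h1
      rw [mem_gammaSet_iff hd hq0 hq1 hdiag hQ (hgpos t h0.le h1)]
      have h2 := sigmaFun_interpolate_le hq0 hq1 hg0 hgmax h0.le h1
      have h3 := mul_le_mul_of_nonneg_left hS (sub_nonneg.2 h1)
      calc SigmaFun q (g t) ≤ (1 - t) * SigmaFun q (ghat mu ν) := h2
        _ < 1 := by linarith
    have hne : (F '' GammaSet d (hitQ G)).Nonempty := ⟨_, g 1, hgmem 1 one_pos le_rfl, rfl⟩
    apply le_antisymm (csSup_le hne hub)
    refine le_of_forall_lt fun c hc => ?_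
    obtain ⟨c', hcc', hc'⟩ := exists_between hc
    have hev : ∀ i, ∀ᶠ t in nhdsWithin (0 : ℝ) (Set.Ioi 0),
        c' < g t i * (mu i / (1 + g t i) - ν i) := by
      intro i
      have hgi : g 0 i = ghat mu ν i := by simp [hg]
      have hc1 : ContinuousAt (fun t => g t i) 0 := by
        simp only [hg]
        fun_prop
      have hc2 : ContinuousAt (fun t => g t i * (mu i / (1 + g t i) - ν i)) 0 := by
        refine hc1.mul ((continuousAt_const.div (continuousAt_const.add hc1) ?_).sub
          continuousAt_const)
        exact (add_pos one_pos (hgpos 0 le_rfl zero_le_one i)).ne'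
      refine (hc2.mono_left nhdsWithin_le_nhds).eventually (lt_mem_nhds ?_)
      change c' < g 0 i * (mu i / (1 + g 0 i) - ν i)
      rw [hgi]
      exact hc'.trans_le (le_payoff_of_roots_bounds (hνpos i) (hg0 i).le
        (discriminant_nonneg (hνpos i) (hB i) (hmle i)) (hga i) (min_le_left _ _))
    obtain ⟨t, ht, ht01⟩ := ((eventually_all.2 hev).and
      (Ioo_mem_nhdsGT (one_pos : (0 : ℝ) < 1))).exists
    calc c < c' := hcc'
      _ ≤ F (g t) := le_ciInf fun i => (ht i).le
      _ ≤ _ := le_csSup hbdd ⟨g t, hgmem t ht01.1 ht01.2.le, rfl⟩
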